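/- Let W be the Weyl group of type C_{n+1}, P = P_k the maximal parabolic (1 < k ≤ n+1). With z_2 W_P := s_{2t_1} · (s_{2t_1} W_P) (Hecke product), one has z_2 W_P = s_{t_1+t_2} W_P, and ℓ(z_2 W_P) = 2(2n+3-k) - 3 = 4n+3-2k. -/

import Mathlib

def bar (n : ℕ) (i : Fin (2*n+2)) : Fin (2*n+2) := ⟨2*n+1 - i, by have := i.isLt; omega⟩

def IsSigned (n : ℕ) (w : Equiv.Perm (Fin (2*n+2))) : Prop :=
  ∀ i, w (bar n i) = bar n (w i)

def IsOddSymp (n : ℕ) (w : Equiv.Perm (Fin (2*n+2))) : Prop :=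
  ∀ j : Fin (2*n+2), (j : ℕ) < n+1 → (w j : ℕ) ≠ 2*n+1

def sgen (n : ℕ) (i : Fin (n+1)) : Equiv.Perm (Fin (2*n+2)) :=
  if h : (i : ℕ) < n then
    (Equiv.swap ⟨i, by omega⟩ ⟨(i : ℕ)+1, by omega⟩) *
      (Equiv.swap ⟨2*n - i, by omega⟩ ⟨2*n+1 - i, by omega⟩)
  else Equiv.swap ⟨n, by omega⟩ ⟨n+1, by omega⟩

noncomputable def len (n : ℕ) (w : Equiv.Perm (Fin (2*n+2))) : ℕ :=
  sInf {m | ∃ l : List (Fin (n+1)), l.length = m ∧ (l.map (sgen n)).prod = w}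

def WP (n k : ℕ) : Subgroup (Equiv.Perm (Fin (2*n+2))) :=
  Subgroup.closure {x | ∃ i : Fin (n+1), (i : ℕ) ≠ k - 1 ∧ x = sgen n i}

noncomputable def IsMinRep (n k : ℕ) (w : Equiv.Perm (Fin (2*n+2))) : Prop :=
  ∀ p ∈ WP n k, len n w ≤ len n (w * p)

noncomputable def cosetLen (n k : ℕ) (w : Equiv.Perm (Fin (2*n+2))) : ℕ :=
  sInf {m | ∃ p ∈ WP n k, len n (w * p) = m}

def s2t1 (n : ℕ) : Equiv.Perm (Fin (2*n+2)) := Equiv.swap ⟨0, by omega⟩ ⟨2*n+1, by omega⟩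

def st1t2 (n : ℕ) : Equiv.Perm (Fin (2*n+2)) :=
  Equiv.swap ⟨0, by omega⟩ ⟨2*n, by omega⟩ * Equiv.swap ⟨1, by omega⟩ ⟨2*n+1, by omega⟩

def sv (n i x : ℕ) : ℕ :=
  if i < n then
    (if x = i then i+1 else if x = i+1 then i else if x = 2*n - i then 2*n+1-i
      else if x = 2*n+1-i then 2*n-i else x)
  else (if x = n then n+1 else if x = n+1 then n else x)

lemma sgen_val (n : ℕ) (i : Fin (n+1)) (x : Fin (2*n+2)) : (sgen n i x : ℕ) = sv n i x := by
  have hi := i.isLt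
  have hx := x.isLt
  unfold sgen sv
  split_ifs with h1 <;>
    simp only [Equiv.Perm.mul_apply, Equiv.swap_apply_def, Fin.ext_iff] <;>
    split_ifs <;> simp_all [Fin.ext_iff] <;> omega

lemma sgen_sq (n : ℕ) (i : Fin (n+1)) : sgen n i * sgen n i = 1 := by
  ext x
  have hi := i.isLt
  have hx := x.isLt
  simp only [Equiv.Perm.mul_apply, sgen_val, Equiv.Perm.one_apply]
  unfold sv
  split_ifs <;> omega

lemma sgen_signed (n : ℕ) (i : Fin (n+1)) : IsSigned n (sgen n i) := by
  intro x
  ext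
  have hi := i.isLt
  have hx := x.isLt
  have h2 := sgen_val n i x
  simp only [bar, sgen_val]
  unfold sv
  split_ifs <;> omega

lemma one_signed (n : ℕ) : IsSigned n 1 := fun _ => rfl

lemma mul_signed {n : ℕ} {a b : Equiv.Perm (Fin (2*n+2))} (ha : IsSigned n a)
    (hb : IsSigned n b) : IsSigned n (a * b) := by
  intro x
  simp only [Equiv.Perm.mul_apply]
  rw [hb, ha]

/-- `w` has a word of length `m`. -/
def Wd (n : ℕ) (w : Equiv.Perm (Fin (2*n+2))) (m : ℕ) : Prop :=
  ∃ l : List (Fin (n+1)), l.length = m ∧ (l.map (sgen n)).prod = w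

lemma Wd.len_le {n : ℕ} {w : Equiv.Perm (Fin (2*n+2))} {m : ℕ} (h : Wd n w m) : len n w ≤ m :=
  Nat.sInf_le h

lemma Wd.len_wd {n : ℕ} {w : Equiv.Perm (Fin (2*n+2))} {m : ℕ} (h : Wd n w m) :
    Wd n w (len n w) :=
  Nat.sInf_mem (s := {m | ∃ l : List (Fin (n+1)), l.length = m ∧ (l.map (sgen n)).prod = w})
    ⟨m, h⟩

lemma Wd.mul {n : ℕ} {w v : Equiv.Perm (Fin (2*n+2))} {m m' : ℕ} (h : Wd n w m)
    (h' : Wd n v m') : Wd n (w * v) (m + m') := by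
  obtain ⟨l, hl, rfl⟩ := h
  obtain ⟨l', hl', rfl⟩ := h'
  exact ⟨l ++ l', by simp [hl, hl'], by simp⟩

lemma Wd.gen {n : ℕ} (i : Fin (n+1)) : Wd n (sgen n i) 1 := ⟨[i], rfl, by simp⟩

lemma Wd.one {n : ℕ} : Wd n 1 0 := ⟨[], rfl, by simp⟩

lemma Wd.signed {n : ℕ} {w : Equiv.Perm (Fin (2*n+2))} {m : ℕ} (h : Wd n w m) :
    IsSigned n w := by
  obtain ⟨l, -, rfl⟩ := h
  induction l with
  | nil => exact one_signed n
  | cons i l ih =>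
    rw [List.map_cons, List.prod_cons]
    exact mul_signed (sgen_signed n i) ih

lemma len_mul_le {n : ℕ} {w v : Equiv.Perm (Fin (2*n+2))} {m m' : ℕ} (h : Wd n w m)
    (h' : Wd n v m') : len n (w * v) ≤ len n w + len n v :=
  (h.len_wd.mul h'.len_wd).len_le

/-- The potential of a pair, for cosets of the parabolic of type `{2}`. -/
def pot (n a b : ℕ) : ℕ := a + b - (if 2*n+1 < a + b then 1 else 0)

/-- The potential of an ordered pair. -/
def potO (n a b : ℕ) : ℕ := pot n a b + (if b < a then 1 else 0)

set_option maxHeartbeats 4000000 in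
lemma sv_pot (n i a b : ℕ) (hi : i ≤ n) (ha : a < 2*n+2) (hb : b < 2*n+2) (hab : a ≠ b)
    (hs : a + b ≠ 2*n+1) : pot n (sv n i a) (sv n i b) ≤ pot n a b + 1 ∧
      potO n (sv n i a) (sv n i b) ≤ potO n a b + 1 := by
  have A : ∀ x, x < 2*n+2 → (i < n ∧ x = i ∧ sv n i x = i+1) ∨ (i < n ∧ x = i+1 ∧ sv n i x = i) ∨
      (i < n ∧ x = 2*n-i ∧ sv n i x = 2*n+1-i) ∨ (i < n ∧ x = 2*n+1-i ∧ sv n i x = 2*n-i) ∨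
      (i = n ∧ x = n ∧ sv n i x = n+1) ∨ (i = n ∧ x = n+1 ∧ sv n i x = n) ∨
      (x ≠ i ∧ x ≠ i+1 ∧ x ≠ 2*n-i ∧ x ≠ 2*n+1-i ∧ sv n i x = x) := by
    intro x hx
    unfold sv
    split_ifs <;> omega
  have A1 := A a ha
  have A2 := A b hb
  generalize sv n i a = a' at *
  generalize sv n i b = b' at *
  clear A
  unfold potO pot
  rcases A1 with h1|h1|h1|h1|h1|h1|h1 <;> rcases A2 with h2|h2|h2|h2|h2|h2|h2 <;>
    first | (exfalso; omega) | (split_ifs <;> omega)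

lemma bar_ne {n : ℕ} {w : Equiv.Perm (Fin (2*n+2))} (hw : IsSigned n w) {a b : Fin (2*n+2)}
    (hs : (a : ℕ) + b ≠ 2*n+1) : (w a : ℕ) + w b ≠ 2*n+1 := by
  intro h
  have h1 : w a = bar n (w b) := by
    ext; simp only [bar]; omega
  rw [← hw] at h1
  have := congrArg Fin.val (w.injective h1)
  simp only [bar] at this
  have := b.isLt
  omega

lemma word_pot {n : ℕ} {w : Equiv.Perm (Fin (2*n+2))} {m : ℕ} (h : Wd n w m)
    (a b : Fin (2*n+2)) (hab : a ≠ b) (hs : (a : ℕ) + b ≠ 2*n+1) :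
    pot n (w a) (w b) ≤ pot n a b + m ∧ potO n (w a) (w b) ≤ potO n a b + m := by
  obtain ⟨l, rfl, rfl⟩ := h
  induction l with
  | nil => simp
  | cons i l ih =>
    have hw : IsSigned n (l.map (sgen n)).prod := Wd.signed ⟨l, rfl, rfl⟩
    rw [List.map_cons, List.prod_cons, List.length_cons]
    simp only [Equiv.Perm.mul_apply, sgen_val]
    generalize (l.map (sgen n)).prod = w at *
    have := sv_pot n i (w a) (w b) (by omega) (w a).isLt (w b).isLt
      (fun h => hab (w.injective (Fin.ext h))) (bar_ne hw hs)
    omega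

/-- The sign change in position `j`. -/
def sc (n j : ℕ) (hj : j ≤ n) : Equiv.Perm (Fin (2*n+2)) :=
  Equiv.swap ⟨j, by omega⟩ ⟨2*n+1-j, by omega⟩

lemma conj_sc {n : ℕ} {w : Equiv.Perm (Fin (2*n+2))} (hw : IsSigned n w) (i j : ℕ) (hi : i ≤ n)
    (hj : j ≤ n) (h : (w ⟨i, by omega⟩ : ℕ) = j) : w * sc n i hi = sc n j hj * w := by
  have h1 : w ⟨i, by omega⟩ = ⟨j, by omega⟩ := Fin.ext h
  have h2 : w ⟨2*n+1-i, by omega⟩ = ⟨2*n+1-j, by omega⟩ := by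
    have := hw ⟨i, by omega⟩
    rw [h1] at this
    exact this
  unfold sc
  rw [Equiv.mul_swap_eq_swap_mul, h1, h2]

lemma sgen_sc (n j : ℕ) (hj : j < n) :
    sgen n ⟨j, by omega⟩ * sc n (j+1) hj = sc n j hj.le * sgen n ⟨j, by omega⟩ := by
  apply conj_sc (sgen_signed n _)
  rw [sgen_val]; simp [sv, hj]

lemma sgen_sc' (n j : ℕ) (hj : j < n) :
    sgen n ⟨j, by omega⟩ * sc n j hj.le = sc n (j+1) hj * sgen n ⟨j, by omega⟩ := by
  apply conj_sc (sgen_signed n _)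
  rw [sgen_val]; simp [sv, hj]

lemma sc_wd (n m : ℕ) (hm : m ≤ n) : Wd n (sc n (n-m) (by omega)) (2*m+1) := by
  induction m with
  | zero =>
    convert Wd.gen (n := n) ⟨n, by omega⟩ using 1
    unfold sc sgen
    simp
    congr 2
    omega
  | succ m ih =>
    have := ih (by omega)
    obtain ⟨j, hj⟩ : ∃ j, n = j + (m+1) := ⟨n-(m+1), by omega⟩
    have e1 : n - m = j+1 := by omega
    have e2 : n - (m+1) = j := by omega
    simp only [e1] at this
    simp only [e2]
    have h3 := ((Wd.gen (n := n) ⟨j, by omega⟩).mul this).mul (Wd.gen (n := n) ⟨j, by omega⟩)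
    rw [sgen_sc n j (by omega), mul_assoc, sgen_sq, mul_one] at h3
    convert h3 using 1
    omega

lemma sc_wd' (n j : ℕ) (hj : j ≤ n) : Wd n (sc n j hj) (2*(n-j)+1) := by
  have := sc_wd n (n-j) (by omega)
  convert this using 2
  omega

lemma sc_comm (n i j : ℕ) (hi : i ≤ n) (hj : j ≤ n) (hij : i ≠ j) :
    sc n i hi * sc n j hj = sc n j hj * sc n i hi := by
  apply conj_sc (Wd.signed (sc_wd' n i hi))
  unfold sc
  rw [Equiv.swap_apply_of_ne_of_ne] <;> simp [Fin.ext_iff] <;> omega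

/-- The rising product `s_a s_{a+1} ⋯ s_{a+m-1}`. -/
lemma rise (n k m a : ℕ) (h : a + m < k) (hk : k ≤ n+1) :
    ∃ w : Equiv.Perm (Fin (2*n+2)), Wd n w m ∧ w ∈ WP n k ∧
      (w ⟨a+m, by omega⟩ : ℕ) = a ∧ (∀ x : Fin (2*n+2), (x : ℕ) < a → w x = x) ∧
      (∀ x : Fin (2*n+2), a + m < (x : ℕ) → (x : ℕ) ≤ n → w x = x) := by
  induction m generalizing a with
  | zero => exact ⟨1, Wd.one, Subgroup.one_mem _, by simp, by simp, by simp⟩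
  | succ m ih =>
    obtain ⟨w, h1, h2, h3, h4, h5⟩ := ih (a+1) (by omega)
    refine ⟨sgen n ⟨a, by omega⟩ * w, ?_, ?_, ?_, ?_, ?_⟩
    · rw [add_comm m 1]; exact (Wd.gen _).mul h1
    · exact Subgroup.mul_mem _ (Subgroup.subset_closure ⟨_, by simp; omega, rfl⟩) h2
    · have e : (⟨a+(m+1), by omega⟩ : Fin (2*n+2)) = ⟨a+1+m, by omega⟩ := by
        ext; simp; omega
      rw [Equiv.Perm.mul_apply, sgen_val, e, h3]
      have : a < n := by omega
      simp [sv, this]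
    · intro x hx
      rw [Equiv.Perm.mul_apply, h4 x (by omega)]
      ext
      rw [sgen_val]
      simp only [sv]
      split_ifs <;> omega
    · intro x hx hx'
      rw [Equiv.Perm.mul_apply, h5 x (by omega) hx']
      ext
      rw [sgen_val]
      simp only [sv]
      split_ifs <;> omega

lemma WP_pres {n k : ℕ} (hkn : k ≤ n+1) {p : Equiv.Perm (Fin (2*n+2))} (hp : p ∈ WP n k) :
    ∀ x : Fin (2*n+2), (x : ℕ) < k ↔ (p x : ℕ) < k := by
  unfold WP at hp
  induction hp using Subgroup.closure_induction with
  | mem x hx =>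
    obtain ⟨i, hi, rfl⟩ := hx
    intro x
    have := i.isLt
    have := x.isLt
    rw [sgen_val]
    simp only [sv]
    split_ifs <;> omega
  | one => simp
  | mul x y _ _ hx hy =>
    intro a
    rw [Equiv.Perm.mul_apply, ← hx, ← hy]
  | inv x _ hx =>
    intro a
    rw [hx (x⁻¹ a)]
    simp

lemma z_zero {n : ℕ} (hn : 1 ≤ n) :
    ((sc n 0 (by omega) * sc n 1 hn) (⟨0, by omega⟩ : Fin (2*n+2)) : ℕ) = 2*n+1 := by
  rw [sc_comm _ _ _ _ _ (by omega), Equiv.Perm.mul_apply]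
  simp only [sc, Equiv.swap_apply_def, Fin.ext_iff]
  simp
  split_ifs <;> simp_all <;> omega

lemma z_one {n : ℕ} (hn : 1 ≤ n) :
    ((sc n 0 (by omega) * sc n 1 hn) (⟨1, by omega⟩ : Fin (2*n+2)) : ℕ) = 2*n := by
  rw [Equiv.Perm.mul_apply]
  simp only [sc, Equiv.swap_apply_def, Fin.ext_iff]
  simp
  split_ifs <;> simp_all <;> omega

lemma zlower {n k : ℕ} (hk : 2 ≤ k) (hkn : k ≤ n+1) {p : Equiv.Perm (Fin (2*n+2))}
    (hp : p ∈ WP n k) {m : ℕ}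
    (h : Wd n (sc n 0 (by omega) * sc n 1 (by omega) * p) m) : 4*n+3-2*k ≤ m := by
  have hq := WP_pres hkn ((WP n k).inv_mem hp)
  set c := p⁻¹ ⟨0, by omega⟩ with hc
  set d := p⁻¹ ⟨1, by omega⟩ with hd
  have hc' : (c : ℕ) < k := (hq _).1 (by simp; omega)
  have hd' : (d : ℕ) < k := (hq _).1 (by simp; omega)
  have hcd : c ≠ d := by
    rw [hc, hd]
    intro h
    have := p⁻¹.injective h
    simp at this
  have hcd' : (c : ℕ) ≠ d := fun h => hcd (Fin.ext h)
  have := (word_pot h c d hcd (by omega)).1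
  have e1 : p c = ⟨0, by omega⟩ := by simp [hc]
  have e2 : p d = ⟨1, by omega⟩ := by simp [hd]
  have f1 : ((sc n 0 (by omega) * sc n 1 (by omega) * p) c : ℕ) = 2*n+1 := by
    rw [Equiv.Perm.mul_apply, e1, z_zero (by omega)]
  have f2 : ((sc n 0 (by omega) * sc n 1 (by omega) * p) d : ℕ) = 2*n := by
    rw [Equiv.Perm.mul_apply, e2, z_one (by omega)]
  rw [f1, f2] at this
  unfold pot at this
  split_ifs at this <;> omega

lemma zlen {n m : ℕ} (hn : 1 ≤ n) 
    (h : Wd n (sc n 0 (by omega) * sc n 1 (by omega)) m) : 4*n ≤ m := by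
  have := (word_pot h ⟨0, by omega⟩ ⟨1, by omega⟩ (by simp) (by simp; omega)).2
  rw [z_zero hn, z_one hn] at this
  unfold potO pot at this
  simp only at this
  split_ifs at this <;> omega

lemma zrep {n k : ℕ} (hk : 2 ≤ k) (hkn : k ≤ n+1) : ∃ p ∈ WP n k,
    Wd n (sc n 0 (by omega) * sc n 1 (by omega) * p) (4*n+3-2*k) := by
  obtain ⟨j, rfl⟩ : ∃ j, k = j + 2 := ⟨k-2, by omega⟩
  obtain ⟨u, u1, u2, u3, u4, u5⟩ := rise n (j+2) j 1 (by omega) hkn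
  obtain ⟨v, v1, v2, v3, v4, v5⟩ := rise n (j+2) j 0 (by omega) hkn
  have hE := u1.mul v1
  have e1 : u * v * sc n (j+1) (by omega) = sc n 1 (by omega) * (u * v) := by
    apply conj_sc hE.signed
    rw [Equiv.Perm.mul_apply, v5 _ (by simp) (by simp; omega)]
    have e : (⟨j+1, by omega⟩ : Fin (2*n+2)) = ⟨1+j, by omega⟩ := by
      ext; simp; omega
    rw [e, u3]
  have e0 : u * v * sc n j (by omega) = sc n 0 (by omega) * (u * v) := by
    apply conj_sc hE.signed
    have : v ⟨j, by omega⟩ = ⟨0, by omega⟩ := by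
      have e : (⟨j, by omega⟩ : Fin (2*n+2)) = ⟨0+j, by omega⟩ := by
        ext; simp
      rw [e]
      exact Fin.ext v3
    rw [Equiv.Perm.mul_apply, this, u4 _ (by simp)]
  have hs := sgen_sc n j (by omega)
  refine ⟨u * v * sgen n ⟨j, by omega⟩, ?_, ?_⟩
  · exact Subgroup.mul_mem _ (Subgroup.mul_mem _ u2 v2)
      (Subgroup.subset_closure ⟨_, by simp, rfl⟩)
  · have hw := ((hE.mul (sc_wd' n (j+1) (by omega))).mul (Wd.gen ⟨j, by omega⟩)).mul
      (sc_wd' n (j+1) (by omega))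
    convert hw using 1
    · rw [mul_assoc _ (sgen n _) (sc n _ _), hs, e1, sc_comm n 0 1 _ _ (by omega)]
      rw [mul_assoc (sc n 1 _) (u*v), ← mul_assoc (u*v), e0]
      simp only [mul_assoc]
    · omega

lemma hecke_list (n : ℕ)
    (h : Equiv.Perm (Fin (2*n+2)) → Equiv.Perm (Fin (2*n+2)) → Equiv.Perm (Fin (2*n+2)))
    (hassoc : ∀ a b c, IsSigned n a → IsSigned n b → IsSigned n c →
      h (h a b) c = h a (h b c))
    (hone : ∀ a, IsSigned n a → h a 1 = a)
    (hsimp : ∀ w i, IsSigned n w →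
      h w (sgen n i) = if len n w < len n (w * sgen n i) then w * sgen n i else w)
    (u : Equiv.Perm (Fin (2*n+2))) (m : ℕ) (hu : Wd n u m) (l : List (Fin (n+1)))
    (hl : len n u + l.length ≤ len n (u * (l.map (sgen n)).prod)) :
    h u (l.map (sgen n)).prod = u * (l.map (sgen n)).prod := by
  induction l using List.reverseRecOn with
  | nil => simpa using hone u hu.signed
  | append_singleton l i ih =>
    simp only [List.map_append, List.map_cons, List.map_nil, List.prod_append, List.prod_cons,
      List.prod_nil, mul_one, List.length_append, List.length_cons, List.length_nil] at hl ⊢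
    have hv : Wd n (l.map (sgen n)).prod l.length := ⟨l, rfl, rfl⟩
    generalize (l.map (sgen n)).prod = v at *
    have hi := Wd.gen (n := n) i
    have a1 := len_mul_le (hu.mul hv) hi
    have a2 := len_mul_le hu (hv.mul hi)
    have a3 := hv.len_le
    have a4 := hi.len_le
    have a5 := len_mul_le hu hv
    rw [← mul_assoc] at hl a2
    have h1 := hsimp v i hv.signed
    rw [if_pos (by omega)] at h1
    rw [← h1, ← hassoc _ _ _ hu.signed hv.signed hi.signed, ih (by omega),
      hsimp _ _ (hu.mul hv).signed, if_pos (by omega), h1, mul_assoc]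

lemma hecke_mul (n : ℕ)
    (h : Equiv.Perm (Fin (2*n+2)) → Equiv.Perm (Fin (2*n+2)) → Equiv.Perm (Fin (2*n+2)))
    (hassoc : ∀ a b c, IsSigned n a → IsSigned n b → IsSigned n c →
      h (h a b) c = h a (h b c))
    (hone : ∀ a, IsSigned n a → h a 1 = a)
    (hsimp : ∀ w i, IsSigned n w →
      h w (sgen n i) = if len n w < len n (w * sgen n i) then w * sgen n i else w)
    (u v : Equiv.Perm (Fin (2*n+2))) (m m' : ℕ) (hu : Wd n u m) (hv : Wd n v m')
    (hl : m + m' ≤ len n (u * v)) : h u v = u * v := by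
  obtain ⟨l, rfl, rfl⟩ := hv
  apply hecke_list n h hassoc hone hsimp u m hu l
  have := hu.len_le
  omega

lemma hecke_z (n : ℕ) (hn : 1 ≤ n)
    (h : Equiv.Perm (Fin (2*n+2)) → Equiv.Perm (Fin (2*n+2)) → Equiv.Perm (Fin (2*n+2)))
    (hassoc : ∀ a b c, IsSigned n a → IsSigned n b → IsSigned n c →
      h (h a b) c = h a (h b c))
    (hone : ∀ a, IsSigned n a → h a 1 = a)
    (hsimp : ∀ w i, IsSigned n w →
      h w (sgen n i) = if len n w < len n (w * sgen n i) then w * sgen n i else w) :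
    h (sc n 0 (by omega)) (sc n 0 (by omega)) = sc n 0 (by omega) * sc n 1 hn := by
  have hA := sc_wd' n 0 (by omega)
  have hB := sc_wd' n 1 hn
  have hz := zlen hn (hA.mul hB).len_wd
  have hAB := sc_comm n 0 1 (by omega) hn (by omega)
  have r1 := sgen_sc n 0 hn
  have r2 := sgen_sc' n 0 hn
  have hs := Wd.gen (n := n) ⟨0, by omega⟩
  have ss := sgen_sq n ⟨0, by omega⟩
  have hi := hsimp
  generalize sc n 0 (by omega) = A at *
  have e01 : sc n (0+1) hn = sc n 1 hn := rfl
  rw [e01] at r1 r2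
  generalize sc n 1 hn = B at *
  have key := hecke_mul n h hassoc hone hsimp
  have hsA := fun w hw => hsimp w ⟨0, by omega⟩ hw
  generalize sgen n ⟨0, by omega⟩ = s at *
  have lA : len n (A * B) ≤ len n A + len n B := len_mul_le hA hB
  have lB := hB.len_le
  have eA : s * (B * s) = A := by rw [← mul_assoc, r1, mul_assoc, ss, mul_one]
  have k1 : h s (B * s) = A := by
    rw [key s (B * s) _ _ hs (hB.mul hs) (by rw [eA]; omega), eA]
  have lBs : len n A ≤ len n s + len n (B * s) := by
    conv_lhs => rw [← eA]
    exact len_mul_le hs (hB.mul hs)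
  have ls := hs.len_le
  have k2 : h B s = B * s := key B s _ _ hB hs (by omega)
  have k3 : h A s = A := by
    rw [hsA A hA.signed, if_neg]
    have := (hs.mul hB).len_le
    rw [r1] at this
    omega
  have k4 : h A B = A * B := key A B _ _ hA hB (by omega)
  have k5 : h (A * B) s = A * B := by
    rw [hsA _ (hA.mul hB).signed, if_neg]
    have := ((hB.mul hs).mul hB).len_le
    rw [mul_assoc, r1, ← mul_assoc, ← hAB] at this
    omega
  calc h A A = h A (h s (B * s)) := by rw [k1]
    _ = h (h A s) (B * s) := (hassoc _ _ _ hA.signed hs.signed (hB.mul hs).signed).symm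
    _ = h A (h B s) := by rw [k3, k2]
    _ = h (h A B) s := (hassoc _ _ _ hA.signed hB.signed hs.signed).symm
    _ = A * B := by rw [k4, k5]

lemma swap_val {N : ℕ} (a b x : Fin N) : (Equiv.swap a b x : ℕ) =
    if (x : ℕ) = a then (b : ℕ) else if (x : ℕ) = b then (a : ℕ) else x := by
  rw [Equiv.swap_apply_def]
  simp only [Fin.ext_iff, apply_ite Fin.val]

lemma st_eq (n : ℕ) (hn : 1 ≤ n) :
    st1t2 n * sgen n ⟨0, by omega⟩ = sc n 0 (by omega) * sc n 1 hn := by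
  ext x
  have hx := x.isLt
  have h0 := sgen_val n ⟨0, by omega⟩ x
  have hn' : 0 < n := hn
  rw [Equiv.Perm.mul_apply]
  generalize sgen n ⟨0, by omega⟩ x = y at *
  simp only [sv, hn', if_true] at h0
  unfold st1t2 sc
  rw [Equiv.Perm.mul_apply, Equiv.Perm.mul_apply]
  have h1 := swap_val (⟨1, by omega⟩ : Fin (2*n+2)) ⟨2*n+1, by omega⟩ y
  generalize Equiv.swap (⟨1, by omega⟩ : Fin (2*n+2)) ⟨2*n+1, by omega⟩ y = y1 at *
  have h2 := swap_val (⟨1, by omega⟩ : Fin (2*n+2)) ⟨2*n+1-1, by omega⟩ x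
  generalize Equiv.swap (⟨1, by omega⟩ : Fin (2*n+2)) ⟨2*n+1-1, by omega⟩ x = x1 at *
  rw [swap_val, swap_val]
  simp only at h1 h2 ⊢
  generalize (x : ℕ) = x at *
  generalize (y : ℕ) = y at *
  generalize (x1 : ℕ) = x1 at *
  generalize (y1 : ℕ) = y1 at *
  split_ifs at h0 <;> split_ifs at h1 <;> split_ifs at h2 <;> split_ifs <;> omega

lemma Wd.inv {n : ℕ} {w : Equiv.Perm (Fin (2*n+2))} {m : ℕ} (h : Wd n w m) :
    Wd n w⁻¹ m := by
  obtain ⟨l, rfl, rfl⟩ := h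
  induction l with
  | nil => simpa using Wd.one
  | cons i l ih =>
    rw [List.map_cons, List.prod_cons, mul_inv_rev, List.length_cons,
      inv_eq_of_mul_eq_one_left (sgen_sq n i)]
    exact ih.mul (Wd.gen i)

lemma WP_wd {n k : ℕ} {p : Equiv.Perm (Fin (2*n+2))} (hp : p ∈ WP n k) : ∃ m, Wd n p m := by
  unfold WP at hp
  induction hp using Subgroup.closure_induction with
  | mem x hx =>
    obtain ⟨i, hi, rfl⟩ := hx
    exact ⟨_, Wd.gen i⟩
  | one => exact ⟨_, Wd.one⟩
  | mul x y _ _ hx hy =>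
    obtain ⟨a, ha⟩ := hx
    obtain ⟨b, hb⟩ := hy
    exact ⟨_, ha.mul hb⟩
  | inv x _ hx =>
    obtain ⟨a, ha⟩ := hx
    exact ⟨_, ha.inv⟩

/-- With `z_2 W_{P_k} := s_{2t_1} · (s_{2t_1} W_{P_k})` (Hecke product action on cosets,
type `C_{n+1}`, `1 < k ≤ n+1`), one has `z_2 W_{P_k} = s_{t_1+t_2} W_{P_k}` and
`ℓ(z_2 W_{P_k}) = 2(2n+3-k) - 3 = 4n+3-2k`. -/
theorem stmt5 (n k : ℕ) (hk : 2 ≤ k) (hkn : k ≤ n+1)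
    (h : Equiv.Perm (Fin (2*n+2)) → Equiv.Perm (Fin (2*n+2)) → Equiv.Perm (Fin (2*n+2)))
    (hclosed : ∀ a b, IsSigned n a → IsSigned n b → IsSigned n (h a b))
    (hassoc : ∀ a b c, IsSigned n a → IsSigned n b → IsSigned n c →
      h (h a b) c = h a (h b c))
    (hone : ∀ a, IsSigned n a → h a 1 = a)
    (hsimp : ∀ w i, IsSigned n w →
      h w (sgen n i) = if len n w < len n (w * sgen n i) then w * sgen n i else w) :
    (st1t2 n)⁻¹ * h (s2t1 n) (s2t1 n) ∈ WP n k ∧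
      cosetLen n k (h (s2t1 n) (s2t1 n)) = 4*n+3-2*k := by
  have hn : 1 ≤ n := by omega
  have hA : s2t1 n = sc n 0 (by omega) := rfl
  have hz := hecke_z n hn h hassoc hone hsimp
  rw [← hA] at hz
  rw [hz, hA]
  constructor
  · rw [← st_eq n hn, inv_mul_cancel_left]
    exact Subgroup.subset_closure ⟨_, by simp; omega, rfl⟩
  · unfold cosetLen
    obtain ⟨p, hp, hw⟩ := zrep hk hkn
    have h1 := zlower hk hkn hp hw.len_wd
    have h2 := hw.len_le
    have hmem : 4*n+3-2*k ∈ {m | ∃ p ∈ WP n k, len n (sc n 0 (by omega) * sc n 1 hn * p) = m} :=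
      ⟨p, hp, le_antisymm h2 h1⟩
    apply le_antisymm (Nat.sInf_le hmem)
    apply le_csInf ⟨_, hmem⟩
    rintro m ⟨q, hq, rfl⟩
    obtain ⟨m, hm⟩ := WP_wd hq
    exact zlower hk hkn hq
      (((sc_wd' n 0 (by omega)).mul (sc_wd' n 1 hn)).mul hm).len_wd
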